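/- Let X_S and X_M be independent random variables with CDFs F_S(x) = 1 - exp(-2λ_S x) and F_M(x) = 1 - exp(-λ_M π x²) for x ≥ 0, where λ_S, λ_M > 0, let α > 0, and let A > 0. When α_S = α_M = α, the probability of Case 4 has the closed form ℙ(X_S < A^{-1/α} X_M) = sqrt(λ_S²/(λ_M A^{2/α})) · exp(λ_S²/(λ_M π A^{2/α})) · erfc(λ_S/sqrt(λ_M π A^{2/α})). -/

import Mathlib

open MeasureTheory ProbabilityTheory Real Set

/-- The complementary error function `erfc z = (2/√π) ∫_z^∞ exp(-t²) dt`. -/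
noncomputable def erfc (z : ℝ) : ℝ :=
  (2 / Real.sqrt π) * ∫ t in Set.Ioi z, Real.exp (-t ^ 2)

lemma map_eq_expMeasure {Ω : Type*} [MeasurableSpace Ω] {μ : Measure Ω} [IsProbabilityMeasure μ]
    {X : Ω → ℝ} (hX : Measurable X) {r : ℝ} (hr : 0 < r)
    (hnonneg : ∀ x : ℝ, 0 ≤ x → μ {ω | X ω ≤ x} = ENNReal.ofReal (1 - Real.exp (-(r * x))))
    (hneg : ∀ x : ℝ, x < 0 → μ {ω | X ω ≤ x} = 0) :
    μ.map X = expMeasure r := by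
  have := isProbabilityMeasure_expMeasure hr
  have := Measure.isProbabilityMeasure_map hX.aemeasurable (μ := μ)
  refine Measure.ext_of_Iic _ _ fun x => ?_
  rw [← ofReal_cdf (expMeasure r), cdf_expMeasure_eq hr, Measure.map_apply hX measurableSet_Iic]
  split_ifs with hx
  · exact hnonneg x hx
  · rw [ENNReal.ofReal_zero]
    exact hneg x (not_le.mp hx)

lemma setIntegral_Ioi_comp_add_right (f : ℝ → ℝ) (a z : ℝ) :
    ∫ x in Ioi a, f (x + z) = ∫ t in Ioi (a + z), f t := by
  have h := (measurePreserving_add_right (volume : Measure ℝ) z).setIntegral_preimage_emb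
    (measurableEmbedding_addRight z) f (Ioi (a + z))
  simpa using h

/-- Completing the square in the Laplace transform of a half-line Gaussian. -/
lemma integral_exp_mul_gaussian_eq_erfc (l : ℝ) {s : ℝ} (hs : 0 < s) :
    ∫ x in Ioi (0 : ℝ), 2 * l * Real.exp (-(2 * l * x)) * Real.exp (-(s * x) ^ 2)
      = Real.sqrt π * l / s * Real.exp ((l / s) ^ 2) * erfc (l / s) := by
  have hsq (x : ℝ) : 2 * l * Real.exp (-(2 * l * x)) * Real.exp (-(s * x) ^ 2)
      = 2 * l * Real.exp ((l / s) ^ 2) * Real.exp (-(s * x + l / s) ^ 2) := by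
    rw [mul_assoc (2 * l), mul_assoc (2 * l), ← Real.exp_add, ← Real.exp_add]
    congr 2
    field_simp
    ring
  simp_rw [hsq]
  rw [integral_const_mul, integral_comp_mul_left_Ioi (fun t => Real.exp (-(t + l / s) ^ 2)) 0 hs,
    setIntegral_Ioi_comp_add_right (fun t => Real.exp (-t ^ 2)), erfc, mul_zero, zero_add,
    smul_eq_mul]
  have : Real.sqrt π ≠ 0 := by positivity
  field_simp

lemma lintegral_expMeasure {r : ℝ} {f : ℝ → ENNReal} (hf : Measurable f) :
    ∫⁻ x, f x ∂(expMeasure r)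
      = ∫⁻ x in Ioi (0 : ℝ), ENNReal.ofReal (r * Real.exp (-(r * x))) * f x := by
  have hpdf : Measurable (exponentialPDF r) := (measurable_exponentialPDFReal r).ennreal_ofReal
  change ∫⁻ x, f x ∂(volume.withDensity (exponentialPDF r)) = _
  rw [lintegral_withDensity_eq_lintegral_mul _ hpdf hf,
    ← setLIntegral_congr Ioi_ae_eq_Ici.symm, ← lintegral_indicator measurableSet_Ici]
  refine lintegral_congr fun x => ?_
  by_cases hx : 0 ≤ x
  · simp [hx, exponentialPDF_of_nonneg]
  · simp [hx, exponentialPDF_of_neg (not_le.mp hx)]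

theorem case4_association_probability_closed_form
    {Ω : Type*} [MeasurableSpace Ω] (μ : Measure Ω) [IsProbabilityMeasure μ]
    (XS XM : Ω → ℝ) (hXSm : Measurable XS) (hXMm : Measurable XM)
    (hindep : IndepFun XS XM μ)
    (lamS lamM α A : ℝ)
    (hlamS : 0 < lamS) (hlamM : 0 < lamM)
    (hα : 0 < α) (hA : 0 < A)
    (hFS : ∀ x : ℝ, 0 ≤ x →
      μ {ω | XS ω ≤ x} = ENNReal.ofReal (1 - Real.exp (-(2 * lamS * x))))
    (hFSneg : ∀ x : ℝ, x < 0 → μ {ω | XS ω ≤ x} = 0)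
    (hFM : ∀ x : ℝ, 0 ≤ x →
      μ {ω | XM ω ≤ x} = ENNReal.ofReal (1 - Real.exp (-(lamM * π * x ^ 2))))
    (hFMneg : ∀ x : ℝ, x < 0 → μ {ω | XM ω ≤ x} = 0) :
    μ {ω | XS ω < A ^ (-(1 / α)) * XM ω}
      = ENNReal.ofReal (Real.sqrt (lamS ^ 2 / (lamM * A ^ (2 / α)))
          * Real.exp (lamS ^ 2 / (lamM * π * A ^ (2 / α)))
          * erfc (lamS / Real.sqrt (lamM * π * A ^ (2 / α)))) := by
  set c : ℝ := A ^ (1 / α) with hc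
  have hc0 : 0 < c := by positivity
  have hk : A ^ (-(1 / α)) = c⁻¹ := Real.rpow_neg hA.le _
  have hc2 : A ^ (2 / α) = c ^ 2 := by
    rw [hc, ← Real.rpow_natCast, ← Real.rpow_mul hA.le]
    congr 1
    push_cast
    ring
  set s : ℝ := Real.sqrt (lamM * π * c ^ 2) with hs
  have hs0 : 0 < s := by positivity
  have hs2 : s ^ 2 = lamM * π * c ^ 2 := Real.sq_sqrt (by positivity)
  have htail (x : ℝ) (hx : 0 ≤ x) :
      μ.map XM {y | x < c⁻¹ * y} = ENNReal.ofReal (Real.exp (-(s * x) ^ 2)) := by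
    have hset : XM ⁻¹' {y | x < c⁻¹ * y} = {ω | XM ω ≤ c * x}ᶜ := by
      ext ω
      simp [lt_inv_mul_iff₀ hc0]
    rw [Measure.map_apply hXMm (measurableSet_lt (by fun_prop) (by fun_prop)), hset,
      prob_compl_eq_one_sub (measurableSet_le hXMm measurable_const), hFM _ (by positivity),
      ← ENNReal.ofReal_one, ← ENNReal.ofReal_sub _ (sub_nonneg.mpr ?_)]
    · rw [sub_sub_cancel, mul_pow s, hs2]
      ring_nf
    · exact Real.exp_le_one_iff.mpr (neg_nonpos.mpr (by positivity))
  have hmeas : MeasurableSet {p : ℝ × ℝ | p.1 < c⁻¹ * p.2} :=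
    measurableSet_lt (by fun_prop) (by fun_prop)
  have hprob := Measure.isProbabilityMeasure_map hXMm.aemeasurable (μ := μ)
  have hmeasM : Measurable fun x => μ.map XM {y | x < c⁻¹ * y} :=
    measurable_measure_prodMk_left hmeas
  have hprod : μ {ω | XS ω < c⁻¹ * XM ω}
      = ∫⁻ x, μ.map XM {y | x < c⁻¹ * y} ∂(expMeasure (2 * lamS)) := by
    rw [← map_eq_expMeasure hXSm (by positivity) hFS hFSneg]
    have h := Measure.prod_apply (μ := μ.map XS) (ν := μ.map XM) hmeas
    rw [← hindep.map_prod_eq_prod_map_map hXSm.aemeasurable hXMm.aemeasurable,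
      Measure.map_apply (hXSm.prodMk hXMm) hmeas] at h
    exact h
  have hintegrable : IntegrableOn
      (fun x => 2 * lamS * Real.exp (-(2 * lamS * x)) * Real.exp (-(s * x) ^ 2)) (Ioi 0) := by
    have h := (integrableOn_exp_mul_Ioi (a := -(2 * lamS)) (by linarith) 0).const_mul (2 * lamS)
    refine Integrable.mono' h (by fun_prop) (ae_of_all _ fun x => ?_)
    rw [Real.norm_of_nonneg (by positivity), neg_mul]
    refine mul_le_of_le_one_right (by positivity) (Real.exp_le_one_iff.mpr ?_)
    exact neg_nonpos.mpr (sq_nonneg _)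
  rw [hk, hc2, ← hs, hprod, lintegral_expMeasure hmeasM,
    setLIntegral_congr_fun measurableSet_Ioi (g := fun x => ENNReal.ofReal
      (2 * lamS * Real.exp (-(2 * lamS * x)) * Real.exp (-(s * x) ^ 2))),
    ← ofReal_integral_eq_lintegral_ofReal hintegrable (ae_of_all _ fun x => by positivity),
    integral_exp_mul_gaussian_eq_erfc lamS hs0]
  · have hsqrt : Real.sqrt (lamS ^ 2 / (lamM * c ^ 2)) = Real.sqrt π * lamS / s := by
      rw [Real.sqrt_eq_iff_mul_self_eq (by positivity) (by positivity), ← sq, div_pow, mul_pow,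
        hs2, Real.sq_sqrt pi_pos.le]
      field_simp
    rw [hsqrt, div_pow, hs2]
  · intro x hx
    beta_reduce
    rw [htail x (le_of_lt hx), ← ENNReal.ofReal_mul (by positivity)]
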